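/- Let L > 0 and let t ↦ Tr_N(t) := Σ_{n=0}^∞ exp(−t·n²π²/L²) be the heat trace of −d²/dx² on the interval [0,L] with Neumann boundary conditions at both endpoints (whose eigenvalues are n²π²/L² for n = 0, 1, 2, …). Then the series converges for every t > 0, and lim_{t→0⁺} ( Tr_N(t) − L/(2√(πt)) ) = +1/2. -/

import Mathlib

open Real Set Filter

open HurwitzKernelBounds in
theorem summable_exp_neg_pi_mul_nat_sq {a : ℝ} (ha : 0 < a) :
    Summable fun n : ℕ => Real.exp (-π * a * (n : ℝ) ^ 2) := by
  convert summable_f_nat 0 0 ha using 2 with n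
  simp only [f_nat, pow_zero, one_mul, add_zero]
  ring_nf

theorem tsum_int_exp_neg_pi_mul_sq {a : ℝ} (ha : 0 < a) :
    ∑' n : ℤ, Real.exp (-π * a * (n : ℝ) ^ 2) =
      2 * ∑' n : ℕ, Real.exp (-π * a * (n : ℝ) ^ 2) - 1 := by
  have h := summable_exp_neg_pi_mul_nat_sq ha
  rw [Summable.tsum_of_nat_of_neg (by simpa using h) (by simpa using h)]
  simp [two_mul]

/-- Poisson summation for the Gaussian, written as a sum over `ℕ`. -/
theorem tsum_nat_exp_neg_pi_mul_sq {a : ℝ} (ha : 0 < a) :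
    ∑' n : ℕ, Real.exp (-π * a * (n : ℝ) ^ 2) - a⁻¹ ^ (1 / 2 : ℝ) / 2 =
      1 / 2 + a⁻¹ ^ (1 / 2 : ℝ) *
        (∑' n : ℕ, Real.exp (-π * a⁻¹ * (n : ℝ) ^ 2) - 1) := by
  have h := Real.tsum_exp_neg_mul_int_sq ha
  simp only [div_eq_mul_inv (-π) a] at h
  rw [tsum_int_exp_neg_pi_mul_sq ha, tsum_int_exp_neg_pi_mul_sq (inv_pos.2 ha), one_div,
    ← Real.inv_rpow ha.le] at h
  linear_combination h / 2

open HurwitzKernelBounds in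
theorem tendsto_rpow_mul_tsum_nat_exp_sub_one (s : ℝ) :
    Tendsto (fun b : ℝ => b ^ s * (∑' n : ℕ, Real.exp (-π * b * (n : ℝ) ^ 2) - 1))
      atTop (nhds 0) := by
  obtain ⟨p, hp, hO⟩ := isBigO_atTop_F_nat_zero_sub le_rfl
  have hF (b : ℝ) : F_nat 0 0 b = ∑' n : ℕ, Real.exp (-π * b * (n : ℝ) ^ 2) := by
    simp only [F_nat, f_nat, pow_zero, one_mul, add_zero, mul_right_comm]
  simp only [hF, if_true] at hO
  exact ((Asymptotics.isBigO_refl (fun b : ℝ => b ^ s) atTop).mul hO).trans_tendsto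
    (tendsto_rpow_mul_exp_neg_mul_atTop_nhds_zero s p hp)

/-- Heat trace of `-d²/dx²` on `[0,L]` with Neumann conditions at both ends:
the series `Σ_{n≥0} exp(-t n²π²/L²)` converges for all `t > 0` and
`Tr_N(t) - L/(2√(πt)) → +1/2` as `t → 0⁺`. -/
theorem heat_trace_neumann_interval (L : ℝ) (hL : 0 < L) :
    (∀ t : ℝ, 0 < t →
      Summable fun n : ℕ =>
        Real.exp (-(t * (n : ℝ) ^ 2 * π ^ 2 / L ^ 2)))
    ∧
    Tendsto
      (fun t : ℝ =>
        (∑' n : ℕ, Real.exp (-(t * (n : ℝ) ^ 2 * π ^ 2 / L ^ 2)))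
          - L / (2 * Real.sqrt (π * t)))
      (nhdsWithin 0 (Ioi 0)) (nhds (1 / 2)) := by
  have hc : 0 < π / L ^ 2 := by positivity
  have hexp (t : ℝ) (n : ℕ) : -(t * (n : ℝ) ^ 2 * π ^ 2 / L ^ 2) =
      -π * (π / L ^ 2 * t) * (n : ℝ) ^ 2 := by ring
  simp only [hexp]
  refine ⟨fun t ht => summable_exp_neg_pi_mul_nat_sq (mul_pos hc ht), ?_⟩
  have hinv : Tendsto (fun t : ℝ => (π / L ^ 2 * t)⁻¹) (nhdsWithin 0 (Ioi 0)) atTop := by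
    simp only [mul_inv]
    exact tendsto_inv_nhdsGT_zero.const_mul_atTop (inv_pos.2 hc)
  have hlim := ((tendsto_rpow_mul_tsum_nat_exp_sub_one (1 / 2)).comp hinv).const_add (1 / 2)
  rw [add_zero] at hlim
  refine hlim.congr' ?_
  filter_upwards [self_mem_nhdsWithin] with t (ht : 0 < t)
  have hsqrt : (π / L ^ 2 * t)⁻¹ ^ (1 / 2 : ℝ) / 2 = L / (2 * Real.sqrt (π * t)) := by
    rw [← Real.sqrt_eq_rpow, show (π / L ^ 2 * t)⁻¹ = L ^ 2 / (π * t) by field_simp,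
      Real.sqrt_div (sq_nonneg L), Real.sqrt_sq hL.le, div_div, mul_comm 2]
  rw [← hsqrt, tsum_nat_exp_neg_pi_mul_sq (mul_pos hc ht), Function.comp_apply]
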